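/- Let n ≥ 3. For x = (x', x_n) ∈ ℝⁿ with x_n > 0 and x' ∈ ℝ^{n-1}, it holds that ∫_{ℝ^{n-1}} ∂_{x_n} N(y', x_n) N(x'-y', 0) dy' = (1/2) N(x), where N is the Newtonian kernel on ℝⁿ and N(·, 0) denotes its restriction to the hyperplane x_n = 0. -/

import Mathlib

open Real MeasureTheory Set

theorem lintegral_rpow_mul_exp_neg_mul_Ioi {a r : ℝ} (ha : 0 < a) (hr : 0 < r) :
    ∫⁻ t in Ioi (0 : ℝ), ENNReal.ofReal (t ^ (a - 1) * exp (-(r * t))) =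
      ENNReal.ofReal ((1 / r) ^ a * Gamma a) := by
  have h := integral_rpow_mul_exp_neg_mul_Ioi ha hr
  have hpos : 0 < (1 / r) ^ a * Gamma a := mul_pos (by positivity) (Gamma_pos_of_pos ha)
  rw [← h, ofReal_integral_eq_lintegral_ofReal]
  · by_contra hc
    rw [integral_undef hc] at h
    exact hpos.ne h
  · filter_upwards [ae_restrict_mem measurableSet_Ioi] with t ht
    have : (0 : ℝ) < t := ht
    show 0 ≤ t ^ (a - 1) * exp (-(r * t))
    positivity

theorem lintegral_exp_neg_mul_sq_norm_mul_exp {V : Type*} [NormedAddCommGroup V]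
    [InnerProductSpace ℝ V] [FiniteDimensional ℝ V] [MeasurableSpace V] [BorelSpace V]
    {s u : ℝ} (hs : 0 < s) (hu : 0 < u) (x : V) :
    ∫⁻ y : V, ENNReal.ofReal (exp (-(s * ‖y‖ ^ 2)) * exp (-(u * ‖x - y‖ ^ 2))) =
      ENNReal.ofReal ((π / (s + u)) ^ ((Module.finrank ℝ V : ℝ) / 2) *
        exp (-(s * u / (s + u) * ‖x‖ ^ 2))) := by
  have hsu : 0 < s + u := by positivity
  have h := GaussianFourier.integral_rexp_neg_mul_sq_norm (V := V) hsu
  have hpos : 0 < (π / (s + u)) ^ ((Module.finrank ℝ V : ℝ) / 2) := by positivity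
  have key : ∀ y : V, exp (-(s * ‖y‖ ^ 2)) * exp (-(u * ‖x - y‖ ^ 2)) =
      exp (-(s * u / (s + u) * ‖x‖ ^ 2)) * exp (-(s + u) * ‖y - (u / (s + u)) • x‖ ^ 2) := by
    intro y
    rw [← exp_add, ← exp_add, norm_sub_sq_real, norm_sub_sq_real, inner_smul_right, norm_smul,
      mul_pow, norm_eq_abs, sq_abs, real_inner_comm]
    congr 1
    field_simp
    ring
  simp_rw [key, ENNReal.ofReal_mul (exp_pos _).le]
  rw [lintegral_const_mul' _ _ ENNReal.ofReal_ne_top,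
    lintegral_sub_right_eq_self (fun y : V => ENNReal.ofReal (exp (-(s + u) * ‖y‖ ^ 2))),
    ← ofReal_integral_eq_lintegral_ofReal, h, ENNReal.ofReal_mul hpos.le, mul_comm]
  · by_contra hc
    rw [integral_undef hc] at h
    exact hpos.ne h
  · exact Filter.Eventually.of_forall fun y => (exp_pos _).le

theorem lintegral_Ioi_eq_lintegral_Ioo_parallel_sum {s : ℝ} (hs : 0 < s) (g : ℝ → ENNReal) :
    ∫⁻ u in Ioi (0 : ℝ), g u =
      ∫⁻ w in Ioo 0 s, ENNReal.ofReal (s ^ 2 / (s - w) ^ 2) * g (w * s / (s - w)) := by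
  have himg : (fun w => w * s / (s - w)) '' Ioo 0 s = Ioi 0 := by
    ext u
    simp only [mem_image, mem_Ioo, mem_Ioi]
    constructor
    · rintro ⟨w, ⟨h0, h1⟩, rfl⟩
      have := sub_pos.2 h1
      positivity
    · intro hu
      refine ⟨s * u / (s + u), ⟨by positivity, ?_⟩, ?_⟩
      · rw [div_lt_iff₀ (by positivity)]
        nlinarith
      · have : s - s * u / (s + u) = s ^ 2 / (s + u) := by
          field_simp
          ring
        rw [this]
        field_simp
  rw [← himg, lintegral_image_eq_lintegral_abs_deriv_mul measurableSet_Ioo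
    (f' := fun w => s ^ 2 / (s - w) ^ 2)]
  · refine lintegral_congr fun w => ?_
    rw [abs_of_nonneg (by positivity)]
  · intro w hw
    have h1 : s - w ≠ 0 := (sub_pos.2 hw.2).ne'
    have := ((hasDerivAt_id w).mul_const s).div ((hasDerivAt_id w).const_sub s) h1
    refine (this.congr_deriv ?_).hasDerivWithinAt
    simp only [id]
    congr 1
    ring
  · intro a ha b hb hab
    have h1 : s - a ≠ 0 := (sub_pos.2 ha.2).ne'
    have h2 : s - b ≠ 0 := (sub_pos.2 hb.2).ne'
    simp only at hab
    rw [div_eq_div_iff h1 h2] at hab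
    have : s ^ 2 * (a - b) = 0 := by linear_combination hab
    rcases mul_eq_zero.1 this with h | h
    · exact absurd h (by positivity)
    · linarith

theorem lintegral_Ioi_lintegral_Ioo_eq {h : ℝ → ℝ → ENNReal}
    (hh : Measurable (Function.uncurry h)) :
    ∫⁻ s in Ioi (0 : ℝ), ∫⁻ w in Ioo 0 s, h s w =
      ∫⁻ w in Ioi (0 : ℝ), ∫⁻ v in Ioi (0 : ℝ), h (w + v) w := by
  have h1 : ∀ s : ℝ, ∫⁻ w in Ioo 0 s, h s w =
      ∫⁻ w in Ioi (0 : ℝ), (Iio s).indicator (h s) w := by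
    intro s
    rw [lintegral_indicator measurableSet_Iio, Measure.restrict_restrict measurableSet_Iio,
      inter_comm, Ioi_inter_Iio]
  have hm : Measurable (Function.uncurry fun s w => (Iio s).indicator (h s) w) := by
    have : (Function.uncurry fun s w => (Iio s).indicator (h s) w) =
        {p : ℝ × ℝ | p.2 < p.1}.indicator (Function.uncurry h) := by
      ext ⟨s, w⟩
      simp [indicator, Function.uncurry]
    rw [this]
    exact hh.indicator (measurableSet_lt measurable_snd measurable_fst)
  simp_rw [h1]
  rw [lintegral_lintegral_swap hm.aemeasurable]
  refine setLIntegral_congr_fun measurableSet_Ioi fun w hw => ?_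
  have hw : 0 < w := hw
  rw [← lintegral_indicator measurableSet_Ioi, ← lintegral_indicator measurableSet_Ioi,
    ← lintegral_add_right_eq_self _ w]
  refine lintegral_congr fun v => ?_
  by_cases hv : 0 < v
  · have : ¬ w + v ≤ 0 := by linarith
    simp [indicator, hv, this, add_comm v w]
  · simp [indicator, hv]

theorem parallel_sum_integrand_eq {a t X w v : ℝ} (hw : 0 < w) (hv : 0 < v) :
    (w + v) ^ 2 / (w + v - w) ^ 2 *
      ((w + v) ^ a * (w * (w + v) / (w + v - w)) ^ (a - 1) * exp (-((w + v) * t ^ 2)) *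
        ((π / ((w + v) + w * (w + v) / (w + v - w))) ^ (a + 1 / 2) *
          exp (-((w + v) * (w * (w + v) / (w + v - w)) /
            ((w + v) + w * (w + v) / (w + v - w)) * X)))) =
    π ^ (a + 1 / 2) * (w ^ (a - 1) * exp (-((X + t ^ 2) * w))) *
      (v ^ ((1 / 2 : ℝ) - 1) * exp (-(t ^ 2 * v))) := by
  have e0 : w + v - w = v := by ring
  rw [e0]
  have hs : 0 < w + v := by positivity
  have e1 : (w + v) + w * (w + v) / v = (w + v) ^ 2 / v := by
    field_simp
    ring
  have e2 : (w + v) * (w * (w + v) / v) / ((w + v) ^ 2 / v) = w := by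
    field_simp
  have e3 : exp (-((w + v) * t ^ 2)) * exp (-(w * X)) =
      exp (-((X + t ^ 2) * w)) * exp (-(t ^ 2 * v)) := by
    rw [← exp_add, ← exp_add]
    congr 1
    ring
  rw [e1, e2]
  have e4 : (w + v) ^ 2 / v ^ 2 * ((w + v) ^ a * (w * (w + v) / v) ^ (a - 1) *
      (π / ((w + v) ^ 2 / v)) ^ (a + 1 / 2)) =
      π ^ (a + 1 / 2) * w ^ (a - 1) * v ^ ((1 / 2 : ℝ) - 1) := by
    set s := w + v
    have hpi := pi_pos
    have hsq : s ^ 2 / v ^ 2 = exp (2 * log s - 2 * log v) := by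
      rw [exp_sub, two_mul, two_mul, exp_add, exp_add, exp_log hs, exp_log hv, sq, sq]
    rw [hsq, rpow_def_of_pos hs, rpow_def_of_pos (by positivity : 0 < w * s / v),
      rpow_def_of_pos (by positivity : 0 < π / (s ^ 2 / v)), rpow_def_of_pos hpi,
      rpow_def_of_pos hw, rpow_def_of_pos hv, log_div (by positivity) (by positivity),
      log_div (by positivity) (by positivity), log_div (by positivity) (by positivity),
      log_mul hw.ne' hs.ne', log_pow]
    simp only [← exp_add]
    congr 1
    push_cast
    ring
  linear_combination exp (-((w + v) * t ^ 2)) * exp (-(w * X)) * e4 +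
    π ^ (a + 1 / 2) * w ^ (a - 1) * v ^ ((1 / 2 : ℝ) - 1) * e3

theorem lintegral_lintegral_parallel_sum {a t X : ℝ} (ha : 0 < a) (ht : 0 < t) (hX : 0 ≤ X) :
    ∫⁻ s in Ioi (0 : ℝ), ∫⁻ u in Ioi (0 : ℝ),
      ENNReal.ofReal (s ^ a * u ^ (a - 1) * exp (-(s * t ^ 2)) *
        ((π / (s + u)) ^ (a + 1 / 2) * exp (-(s * u / (s + u) * X)))) =
      ENNReal.ofReal (π ^ (a + 1) / t * Gamma a * (1 / (X + t ^ 2)) ^ a) := by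
  have h1 : ∀ s ∈ Ioi (0 : ℝ), _ = _ := fun s hs =>
    lintegral_Ioi_eq_lintegral_Ioo_parallel_sum hs fun u =>
      ENNReal.ofReal (s ^ a * u ^ (a - 1) * exp (-(s * t ^ 2)) *
        ((π / (s + u)) ^ (a + 1 / 2) * exp (-(s * u / (s + u) * X))))
  rw [setLIntegral_congr_fun measurableSet_Ioi h1, lintegral_Ioi_lintegral_Ioo_eq
    (h := fun s w => ENNReal.ofReal (s ^ 2 / (s - w) ^ 2) *
      ENNReal.ofReal (s ^ a * (w * s / (s - w)) ^ (a - 1) * exp (-(s * t ^ 2)) *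
        ((π / (s + w * s / (s - w))) ^ (a + 1 / 2) *
          exp (-(s * (w * s / (s - w)) / (s + w * s / (s - w)) * X)))))]
  swap
  · unfold Function.uncurry
    fun_prop
  have h2 : ∀ w ∈ Ioi (0 : ℝ), ∫⁻ v in Ioi (0 : ℝ),
      ENNReal.ofReal ((w + v) ^ 2 / (w + v - w) ^ 2) *
      ENNReal.ofReal ((w + v) ^ a * (w * (w + v) / (w + v - w)) ^ (a - 1) *
        exp (-((w + v) * t ^ 2)) *
        ((π / ((w + v) + w * (w + v) / (w + v - w))) ^ (a + 1 / 2) *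
          exp (-((w + v) * (w * (w + v) / (w + v - w)) /
            ((w + v) + w * (w + v) / (w + v - w)) * X)))) =
      ENNReal.ofReal (π ^ (a + 1 / 2) * ((1 / t ^ 2) ^ (1 / 2 : ℝ) * Gamma (1 / 2))) *
        ENNReal.ofReal (w ^ (a - 1) * exp (-((X + t ^ 2) * w))) := by
    intro w hw
    have hw : 0 < w := hw
    rw [setLIntegral_congr_fun (g := fun v =>
        ENNReal.ofReal (π ^ (a + 1 / 2) * (w ^ (a - 1) * exp (-((X + t ^ 2) * w)))) *
          ENNReal.ofReal (v ^ ((1 / 2 : ℝ) - 1) * exp (-(t ^ 2 * v)))) measurableSet_Ioi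
        fun v hv => by
          simp only
          rw [← ENNReal.ofReal_mul (by positivity), parallel_sum_integrand_eq hw hv,
            ENNReal.ofReal_mul (by positivity)],
      lintegral_const_mul' _ _ ENNReal.ofReal_ne_top,
      lintegral_rpow_mul_exp_neg_mul_Ioi (by norm_num) (by positivity),
      ← ENNReal.ofReal_mul (by positivity),
      ← ENNReal.ofReal_mul (by rw [Gamma_one_half_eq]; positivity)]
    congr 1
    ring
  rw [setLIntegral_congr_fun measurableSet_Ioi h2,
    lintegral_const_mul' _ _ ENNReal.ofReal_ne_top,
    lintegral_rpow_mul_exp_neg_mul_Ioi ha (by positivity),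
    ← ENNReal.ofReal_mul (by rw [Gamma_one_half_eq]; positivity)]
  congr 1
  have e1 : (1 / t ^ 2) ^ (1 / 2 : ℝ) = 1 / t := by
    rw [← sqrt_eq_rpow, one_div, sqrt_inv, sqrt_sq ht.le, one_div]
  have e2 : π ^ (a + 1) = π ^ (a + 1 / 2) * √π := by
    rw [sqrt_eq_rpow, ← rpow_add pi_pos]
    norm_num [add_assoc]
  rw [e1, e2, Gamma_one_half_eq]
  ring

theorem lintegral_sq_norm_add_sq_rpow_mul_sq_norm_sub_rpow {V : Type*} [NormedAddCommGroup V]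
    [InnerProductSpace ℝ V] [FiniteDimensional ℝ V] [MeasurableSpace V] [BorelSpace V]
    {a t : ℝ} (ha : 0 < a) (ht : 0 < t) (hV : (Module.finrank ℝ V : ℝ) = 2 * a + 1) (x : V) :
    ∫⁻ y : V, ENNReal.ofReal ((1 / (‖y‖ ^ 2 + t ^ 2)) ^ (a + 1) * (1 / ‖x - y‖ ^ 2) ^ a) =
      ENNReal.ofReal (π ^ (a + 1) / Gamma (a + 1) / t * (1 / (‖x‖ ^ 2 + t ^ 2)) ^ a) := by
  have hG := Gamma_pos_of_pos ha
  have hG1 := Gamma_pos_of_pos (by linarith : 0 < a + 1)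
  have : Nontrivial V := by
    refine Module.nontrivial_of_finrank_pos (R := ℝ) ?_
    have : (0 : ℝ) < Module.finrank ℝ V := by linarith
    exact_mod_cast this
  have hy : ∀ y : V, y ≠ x →
      ∫⁻ s in Ioi (0 : ℝ), ∫⁻ u in Ioi (0 : ℝ),
        ENNReal.ofReal (s ^ a * u ^ (a - 1) * exp (-(s * t ^ 2)) *
          (exp (-(s * ‖y‖ ^ 2)) * exp (-(u * ‖x - y‖ ^ 2)))) =
      ENNReal.ofReal (Gamma (a + 1) * Gamma a) *
        ENNReal.ofReal ((1 / (‖y‖ ^ 2 + t ^ 2)) ^ (a + 1) * (1 / ‖x - y‖ ^ 2) ^ a) := by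
    intro y hyx
    have hxy : 0 < ‖x - y‖ := norm_pos_iff.2 (sub_ne_zero.2 hyx.symm)
    have h1 : ∀ s ∈ Ioi (0 : ℝ), ∫⁻ u in Ioi (0 : ℝ),
        ENNReal.ofReal (s ^ a * u ^ (a - 1) * exp (-(s * t ^ 2)) *
          (exp (-(s * ‖y‖ ^ 2)) * exp (-(u * ‖x - y‖ ^ 2)))) =
        ENNReal.ofReal ((1 / ‖x - y‖ ^ 2) ^ a * Gamma a) *
          ENNReal.ofReal (s ^ (a + 1 - 1) * exp (-((‖y‖ ^ 2 + t ^ 2) * s))) := by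
      intro s hs
      have hs : 0 < s := hs
      have h2 : ∀ u : ℝ, ENNReal.ofReal (s ^ a * u ^ (a - 1) * exp (-(s * t ^ 2)) *
          (exp (-(s * ‖y‖ ^ 2)) * exp (-(u * ‖x - y‖ ^ 2)))) =
          ENNReal.ofReal (s ^ (a + 1 - 1) * exp (-((‖y‖ ^ 2 + t ^ 2) * s))) *
            ENNReal.ofReal (u ^ (a - 1) * exp (-(‖x - y‖ ^ 2 * u))) := by
        intro u
        rw [← ENNReal.ofReal_mul (by positivity), add_sub_cancel_right,
          show -((‖y‖ ^ 2 + t ^ 2) * s) = -(s * t ^ 2) + -(s * ‖y‖ ^ 2) by ring, exp_add,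
          mul_comm u (‖x - y‖ ^ 2)]
        congr 1
        ring
      simp_rw [h2]
      rw [lintegral_const_mul' _ _ ENNReal.ofReal_ne_top,
        lintegral_rpow_mul_exp_neg_mul_Ioi ha (by positivity), mul_comm]
    rw [setLIntegral_congr_fun measurableSet_Ioi h1,
      lintegral_const_mul' _ _ ENNReal.ofReal_ne_top,
      lintegral_rpow_mul_exp_neg_mul_Ioi (by linarith) (by positivity),
      ← ENNReal.ofReal_mul (by positivity), ← ENNReal.ofReal_mul (by positivity)]
    congr 1
    ring
  have hswap : ∫⁻ y : V, ∫⁻ s in Ioi (0 : ℝ), ∫⁻ u in Ioi (0 : ℝ),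
        ENNReal.ofReal (s ^ a * u ^ (a - 1) * exp (-(s * t ^ 2)) *
          (exp (-(s * ‖y‖ ^ 2)) * exp (-(u * ‖x - y‖ ^ 2)))) =
      ∫⁻ s in Ioi (0 : ℝ), ∫⁻ u in Ioi (0 : ℝ), ∫⁻ y : V,
        ENNReal.ofReal (s ^ a * u ^ (a - 1) * exp (-(s * t ^ 2)) *
          (exp (-(s * ‖y‖ ^ 2)) * exp (-(u * ‖x - y‖ ^ 2)))) := by
    rw [lintegral_lintegral_swap]
    · refine lintegral_congr fun s => lintegral_lintegral_swap ?_
      unfold Function.uncurry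
      fun_prop
    · refine Measurable.aemeasurable ?_
      unfold Function.uncurry
      refine Measurable.lintegral_prod_right' (f := fun q : (V × ℝ) × ℝ =>
        ENNReal.ofReal (q.1.2 ^ a * q.2 ^ (a - 1) * exp (-(q.1.2 * t ^ 2)) *
          (exp (-(q.1.2 * ‖q.1.1‖ ^ 2)) * exp (-(q.2 * ‖x - q.1.1‖ ^ 2))))) ?_
      fun_prop
  have hgauss : ∀ s ∈ Ioi (0 : ℝ), ∀ u ∈ Ioi (0 : ℝ), ∫⁻ y : V,
        ENNReal.ofReal (s ^ a * u ^ (a - 1) * exp (-(s * t ^ 2)) *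
          (exp (-(s * ‖y‖ ^ 2)) * exp (-(u * ‖x - y‖ ^ 2)))) =
      ENNReal.ofReal (s ^ a * u ^ (a - 1) * exp (-(s * t ^ 2)) *
        ((π / (s + u)) ^ (a + 1 / 2) * exp (-(s * u / (s + u) * ‖x‖ ^ 2)))) := by
    intro s hs u hu
    have hs : 0 < s := hs
    have hu : 0 < u := hu
    have hc : 0 ≤ s ^ a * u ^ (a - 1) * exp (-(s * t ^ 2)) := by positivity
    simp_rw [ENNReal.ofReal_mul hc]
    rw [lintegral_const_mul' _ _ ENNReal.ofReal_ne_top,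
      lintegral_exp_neg_mul_sq_norm_mul_exp hs hu, hV,
      show (2 * a + 1) / 2 = a + 1 / 2 by ring]
  rw [lintegral_congr_ae ((Measure.ae_ne volume x).mono hy),
    lintegral_const_mul' _ _ ENNReal.ofReal_ne_top,
    setLIntegral_congr_fun measurableSet_Ioi fun s hs =>
      setLIntegral_congr_fun measurableSet_Ioi (hgauss s hs),
    lintegral_lintegral_parallel_sum ha ht (sq_nonneg _)] at hswap
  have hne : ENNReal.ofReal (Gamma (a + 1) * Gamma a) ≠ 0 := by
    rw [Ne, ENNReal.ofReal_eq_zero, not_le]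
    positivity
  rw [← ENNReal.mul_right_inj hne ENNReal.ofReal_ne_top, hswap,
    ← ENNReal.ofReal_mul (by positivity)]
  congr 1
  field_simp

theorem integral_sq_norm_add_sq_rpow_mul_sq_norm_sub_rpow {V : Type*} [NormedAddCommGroup V]
    [InnerProductSpace ℝ V] [FiniteDimensional ℝ V] [MeasurableSpace V] [BorelSpace V]
    {a t : ℝ} (ha : 0 < a) (ht : 0 < t) (hV : (Module.finrank ℝ V : ℝ) = 2 * a + 1) (x : V) :
    ∫ y : V, (1 / (‖y‖ ^ 2 + t ^ 2)) ^ (a + 1) * (1 / ‖x - y‖ ^ 2) ^ a =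
      π ^ (a + 1) / Gamma (a + 1) / t * (1 / (‖x‖ ^ 2 + t ^ 2)) ^ a := by
  have hG1 := Gamma_pos_of_pos (by linarith : 0 < a + 1)
  rw [integral_eq_lintegral_of_nonneg_ae,
    lintegral_sq_norm_add_sq_rpow_mul_sq_norm_sub_rpow ha ht hV,
    ENNReal.toReal_ofReal (by positivity)]
  · exact Filter.Eventually.of_forall fun y => by positivity
  · refine Measurable.aestronglyMeasurable ?_
    fun_prop

/-- half-space Poisson-type identity
`∫_{ℝ^{n-1}} ∂_{x_n} N(y', x_n) N(x'-y', 0) dy' = N(x)/2`. -/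
theorem stmt9 (n : ℕ) (hn : 3 ≤ n)
    (ω : ℝ) (hω : ω = (volume (Metric.ball (0 : EuclideanSpace ℝ (Fin n)) 1)).toReal)
    (Nr : ℝ → ℝ)
    (hNr : ∀ r : ℝ, Nr r = -(1 / ((n:ℝ) * ((n:ℝ) - 2) * ω)) * r ^ ((2:ℝ) - n))
    (x' : EuclideanSpace ℝ (Fin (n - 1))) (xn : ℝ) (hxn : 0 < xn) :
    (∫ y' : EuclideanSpace ℝ (Fin (n - 1)),
        deriv (fun a : ℝ => Nr (Real.sqrt (‖y'‖^2 + a^2))) xn * Nr ‖x' - y'‖)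
      = (1/2) * Nr (Real.sqrt (‖x'‖^2 + xn^2)) := by
  have hn' : (3 : ℝ) ≤ n := by exact_mod_cast hn
  obtain ⟨a, han⟩ : ∃ a : ℝ, (n : ℝ) = 2 * a + 2 := ⟨((n : ℝ) - 2) / 2, by ring⟩
  have ha : 0 < a := by linarith
  have hG := Gamma_pos_of_pos ha
  have hV : (Module.finrank ℝ (EuclideanSpace ℝ (Fin (n - 1))) : ℝ) = 2 * a + 1 := by
    rw [finrank_euclideanSpace_fin, Nat.cast_sub (by lia), han]
    norm_num
    ring
  have hω' : ω = π ^ (a + 1) / ((a + 1) * Gamma (a + 1)) := by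
    have : Nonempty (Fin n) := ⟨⟨0, by lia⟩⟩
    have hsq : √π ^ n = π ^ (a + 1) := by
      rw [← rpow_natCast, sqrt_eq_rpow, ← rpow_mul pi_pos.le, han]
      congr 1
      ring
    rw [hω, EuclideanSpace.volume_ball, Fintype.card_fin, hsq, han,
      show (2 * a + 2) / 2 + 1 = (a + 1) + 1 by ring, Gamma_add_one (by positivity : a + 1 ≠ 0)]
    rw [Gamma_add_one ha.ne']
    simp only [ENNReal.ofReal_one, one_pow, one_mul]
    exact ENNReal.toReal_ofReal (by positivity)
  have hNr' : ∀ r : ℝ, 0 ≤ r → Nr r = -(1 / (n * (n - 2) * ω)) * (1 / r ^ 2) ^ a := by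
    intro r hr
    rw [hNr, han, one_div (r ^ 2), inv_rpow (by positivity), ← rpow_neg (by positivity),
      ← rpow_natCast, ← rpow_mul hr]
    congr 2
    push_cast
    ring
  have hNs : ∀ r : ℝ, 0 ≤ r → Nr (√r) = -(1 / (n * (n - 2) * ω)) * (1 / r) ^ a := by
    intro r hr
    rw [hNr' _ (sqrt_nonneg r), sq_sqrt hr]
  have hderiv : ∀ y' : EuclideanSpace ℝ (Fin (n - 1)),
      deriv (fun a : ℝ => Nr (√(‖y'‖ ^ 2 + a ^ 2))) xn =
        1 / (n * (n - 2) * ω) * (2 * a * xn) * (1 / (‖y'‖ ^ 2 + xn ^ 2)) ^ (a + 1) := by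
    intro y'
    have hp : 0 < ‖y'‖ ^ 2 + xn ^ 2 := by positivity
    have heq : (fun b : ℝ => Nr (√(‖y'‖ ^ 2 + b ^ 2))) = fun b =>
        -(1 / (n * (n - 2) * ω)) * (‖y'‖ ^ 2 + b ^ 2) ^ (-a) := by
      ext b
      rw [hNs _ (by positivity), one_div (‖y'‖ ^ 2 + b ^ 2), inv_rpow (by positivity),
        rpow_neg (by positivity)]
    have h1 : HasDerivAt (fun b : ℝ => ‖y'‖ ^ 2 + b ^ 2) (2 * xn) xn := by
      simpa using (hasDerivAt_pow 2 xn).const_add (‖y'‖ ^ 2)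
    rw [heq, ((h1.rpow_const (p := -a) (Or.inl hp.ne')).const_mul _).deriv,
      one_div (‖y'‖ ^ 2 + xn ^ 2), inv_rpow hp.le, ← rpow_neg hp.le,
      show -(a + 1) = -a - 1 by ring]
    ring
  have hint := integral_sq_norm_add_sq_rpow_mul_sq_norm_sub_rpow ha hxn hV x'
  have hI : ∀ y' : EuclideanSpace ℝ (Fin (n - 1)),
      deriv (fun a : ℝ => Nr (√(‖y'‖ ^ 2 + a ^ 2))) xn * Nr ‖x' - y'‖ =
        -(1 / (n * (n - 2) * ω)) ^ 2 * (2 * a * xn) *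
          ((1 / (‖y'‖ ^ 2 + xn ^ 2)) ^ (a + 1) * (1 / ‖x' - y'‖ ^ 2) ^ a) := by
    intro y'
    rw [hderiv, hNr' _ (norm_nonneg _)]
    ring
  simp_rw [hI]
  rw [integral_const_mul, hint, hNs _ (by positivity), hω', han, Gamma_add_one ha.ne']
  have hπ : 0 < π ^ (a + 1) := by positivity
  generalize (1 / (‖x'‖ ^ 2 + xn ^ 2)) ^ a = R
  rw [add_sub_cancel_right]
  field_simp
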